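/- For every integer n ≥ 0 the boundary-bootstrap identity P^+(u) · a(u−ν_n) · a(u+ν_n) = \bar{P^-}(u) · a^1_n(u) holds at every complex u at which all the infinite products involved converge to nonzero values. In particular, for n = 0 one has P^+(u) a(u−ν_0) a(u+ν_0) = \bar{P^-}(u): the soliton reflection factor off the first excited boundary state |1;0⟩ equals the ground-state anti-soliton reflection factor with ξ replaced by π(λ+1) − ξ. -/

import Mathlib

open Complex Real Filter Topology

/-- The `l`-th factor of the infinite Gamma product defining `ρ(u)`. -/
noncomputable def rhoBlock (lam : ℝ) (u : ℂ) (l : ℕ) : ℂ :=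
  (Complex.Gamma ((2 * (l : ℂ) - 2) * (lam : ℂ) - (lam : ℂ) * u / (Real.pi : ℂ)) *
   Complex.Gamma (1 + 2 * (l : ℂ) * (lam : ℂ) - (lam : ℂ) * u / (Real.pi : ℂ)) *
   Complex.Gamma ((2 * (l : ℂ) - 1) * (lam : ℂ) + (lam : ℂ) * u / (Real.pi : ℂ)) *
   Complex.Gamma (1 + (2 * (l : ℂ) - 1) * (lam : ℂ) + (lam : ℂ) * u / (Real.pi : ℂ))) /
  (Complex.Gamma ((2 * (l : ℂ) - 1) * (lam : ℂ) - (lam : ℂ) * u / (Real.pi : ℂ)) *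
   Complex.Gamma (1 + (2 * (l : ℂ) - 1) * (lam : ℂ) - (lam : ℂ) * u / (Real.pi : ℂ)) *
   Complex.Gamma ((2 * (l : ℂ) - 2) * (lam : ℂ) + (lam : ℂ) * u / (Real.pi : ℂ)) *
   Complex.Gamma (1 + 2 * (l : ℂ) * (lam : ℂ) + (lam : ℂ) * u / (Real.pi : ℂ)))

/-- The `L`-th partial product defining `a(u) = sin(λ(π−u)) ρ(u)`. -/
noncomputable def aPartial (lam : ℝ) (u : ℂ) (L : ℕ) : ℂ :=
  Complex.sin ((lam : ℂ) * ((Real.pi : ℂ) - u)) *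
    ((1 / Complex.sin ((lam : ℂ) * (u - (Real.pi : ℂ)))) *
      ∏ l ∈ Finset.Icc 1 L, rhoBlock lam u l)

/-- The `k`-th factor of the infinite Gamma product defining `R_0(u)`. -/
noncomputable def r0Block (lam : ℝ) (u : ℂ) (k : ℕ) : ℂ :=
  (Complex.Gamma (1 + (lam : ℂ) * (4 * (k : ℂ) - 4) - 2 * (lam : ℂ) * u / (Real.pi : ℂ)) *
   Complex.Gamma (4 * (lam : ℂ) * (k : ℂ) - 2 * (lam : ℂ) * u / (Real.pi : ℂ)) *
   Complex.Gamma ((lam : ℂ) * (4 * (k : ℂ) - 3) + 2 * (lam : ℂ) * u / (Real.pi : ℂ)) *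
   Complex.Gamma (1 + (lam : ℂ) * (4 * (k : ℂ) - 1) + 2 * (lam : ℂ) * u / (Real.pi : ℂ))) /
  (Complex.Gamma ((lam : ℂ) * (4 * (k : ℂ) - 3) - 2 * (lam : ℂ) * u / (Real.pi : ℂ)) *
   Complex.Gamma (1 + (lam : ℂ) * (4 * (k : ℂ) - 1) - 2 * (lam : ℂ) * u / (Real.pi : ℂ)) *
   Complex.Gamma (1 + (lam : ℂ) * (4 * (k : ℂ) - 4) + 2 * (lam : ℂ) * u / (Real.pi : ℂ)) *
   Complex.Gamma (4 * (lam : ℂ) * (k : ℂ) + 2 * (lam : ℂ) * u / (Real.pi : ℂ)))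

/-- The `K`-th partial product defining `R_0(u)`. -/
noncomputable def r0Partial (lam : ℝ) (u : ℂ) (K : ℕ) : ℂ :=
  ∏ k ∈ Finset.Icc 1 K, r0Block lam u k

/-- The `l`-th factor of the infinite Gamma product defining the `ξ`-dependent part
`G^+(u)` of `P^+(u) = R_0(u) G^+(u)`; `G^-` is obtained by `ξ ↦ −ξ`. -/
noncomputable def gBlock (lam ξ : ℝ) (u : ℂ) (l : ℕ) : ℂ :=
  (Complex.Gamma (1/2 + 2 * (l : ℂ) * (lam : ℂ) + (ξ : ℂ) / (Real.pi : ℂ) + (lam : ℂ) * u / (Real.pi : ℂ)) *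
   Complex.Gamma (1/2 + (2 * (l : ℂ) - 2) * (lam : ℂ) - (ξ : ℂ) / (Real.pi : ℂ) + (lam : ℂ) * u / (Real.pi : ℂ)) *
   Complex.Gamma (1/2 + (2 * (l : ℂ) - 1) * (lam : ℂ) + (ξ : ℂ) / (Real.pi : ℂ) - (lam : ℂ) * u / (Real.pi : ℂ)) *
   Complex.Gamma (1/2 + (2 * (l : ℂ) - 1) * (lam : ℂ) - (ξ : ℂ) / (Real.pi : ℂ) - (lam : ℂ) * u / (Real.pi : ℂ))) /
  (Complex.Gamma (1/2 + (2 * (l : ℂ) - 1) * (lam : ℂ) + (ξ : ℂ) / (Real.pi : ℂ) + (lam : ℂ) * u / (Real.pi : ℂ)) *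
   Complex.Gamma (1/2 + (2 * (l : ℂ) - 1) * (lam : ℂ) - (ξ : ℂ) / (Real.pi : ℂ) + (lam : ℂ) * u / (Real.pi : ℂ)) *
   Complex.Gamma (1/2 + 2 * (l : ℂ) * (lam : ℂ) + (ξ : ℂ) / (Real.pi : ℂ) - (lam : ℂ) * u / (Real.pi : ℂ)) *
   Complex.Gamma (1/2 + (2 * (l : ℂ) - 2) * (lam : ℂ) - (ξ : ℂ) / (Real.pi : ℂ) - (lam : ℂ) * u / (Real.pi : ℂ)))

/-- The `L`-th partial product defining `G^+(u)` (and `G^-(u) = G^+(u)|_{ξ→−ξ}`). -/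
noncomputable def gPartial (lam ξ : ℝ) (u : ℂ) (L : ℕ) : ℂ :=
  ∏ l ∈ Finset.Icc 1 L, gBlock lam ξ u l

/-- For a real parameter `y`, the trigonometric block
`(y)_u := sin((u+πy)/2)/sin((u−πy)/2)`. -/
noncomputable def blk (y : ℝ) (u : ℂ) : ℂ :=
  Complex.sin ((u + (Real.pi * y : ℝ)) / 2) / Complex.sin ((u - (Real.pi * y : ℝ)) / 2)

/-- The factor `a^1_n(u)` of the excited boundary reflection amplitudes. -/
noncomputable def a1 (lam ξ : ℝ) (n : ℕ) (u : ℂ) : ℂ :=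
  ∏ x ∈ Finset.Icc 1 n,
    (blk (ξ / (lam * Real.pi) + 1 / (2 * lam) - (x : ℝ) / lam) u *
     blk (ξ / (lam * Real.pi) - 1 / (2 * lam) - (x : ℝ) / lam) u) /
    (blk (ξ / (lam * Real.pi) + 1 / (2 * lam) - (x : ℝ) / lam + 1) u *
     blk (ξ / (lam * Real.pi) - 1 / (2 * lam) - (x : ℝ) / lam + 1) u)

/-- The candidate soliton boundary-binding rapidity `ν_n = ξ/λ − (2n+1)π/(2λ)`. -/
noncomputable def nuP (lam ξ : ℝ) (n : ℕ) : ℝ :=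
  ξ / lam - (2 * (n : ℝ) + 1) * Real.pi / (2 * lam)

/-- `rhoBlock` in the rescaled variable `Y = λ u / π`. -/
noncomputable def rB (lam : ℝ) (Y : ℂ) (l : ℕ) : ℂ :=
  (Complex.Gamma ((2 * (l : ℂ) - 2) * (lam : ℂ) - Y) *
   Complex.Gamma (1 + 2 * (l : ℂ) * (lam : ℂ) - Y) *
   Complex.Gamma ((2 * (l : ℂ) - 1) * (lam : ℂ) + Y) *
   Complex.Gamma (1 + (2 * (l : ℂ) - 1) * (lam : ℂ) + Y)) /
  (Complex.Gamma ((2 * (l : ℂ) - 1) * (lam : ℂ) - Y) *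
   Complex.Gamma (1 + (2 * (l : ℂ) - 1) * (lam : ℂ) - Y) *
   Complex.Gamma ((2 * (l : ℂ) - 2) * (lam : ℂ) + Y) *
   Complex.Gamma (1 + 2 * (l : ℂ) * (lam : ℂ) + Y))

/-- No Gamma function in the blocks at `Y` is at a pole. -/
def HH (lam : ℝ) (Y : ℂ) : Prop :=
  ∀ k m : ℕ, ((k : ℂ) * (lam : ℂ) + Y ≠ -(m : ℂ)) ∧ ((k : ℂ) * (lam : ℂ) - Y ≠ -(m : ℂ))

/-- The rational shift factor of `rB`. -/
noncomputable def rS (lam : ℝ) (Y : ℂ) (j : ℕ) : ℂ :=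
  (((2 * (j : ℂ) + 1) * lam + Y) * ((2 * (j : ℂ) + 1) * lam + (Y + 1)) *
    ((2 * (j : ℂ) + 1) * lam - Y) * ((2 * (j : ℂ) + 1) * lam - (Y + 1))) /
  ((2 * (j : ℂ) * lam - (Y + 1)) * (2 * (j : ℂ) * lam + Y) *
    (2 * ((j : ℂ) + 1) * lam - Y) * (2 * ((j : ℂ) + 1) * lam + (Y + 1)))

lemma HH.pos {lam : ℝ} {Y : ℂ} (h : HH lam Y) (k m : ℕ) {s : ℂ}
    (hs : s = k * lam + Y + m) : Complex.Gamma s ≠ 0 := by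
  apply Complex.Gamma_ne_zero
  intro i hi
  apply (h k (i + m)).1
  push_cast
  rw [neg_add, ← hi, hs]; ring

lemma HH.neg {lam : ℝ} {Y : ℂ} (h : HH lam Y) (k m : ℕ) {s : ℂ}
    (hs : s = k * lam - Y + m) : Complex.Gamma s ≠ 0 := by
  apply Complex.Gamma_ne_zero
  intro i hi
  apply (h k (i + m)).2
  push_cast
  rw [neg_add, ← hi, hs]; ring

lemma HH.pos0 {lam : ℝ} {Y : ℂ} (h : HH lam Y) (k : ℕ) {s : ℂ}
    (hs : s = k * lam + Y) : s ≠ 0 := by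
  have := (h k 0).1
  rw [hs]; simpa using this

lemma HH.neg0 {lam : ℝ} {Y : ℂ} (h : HH lam Y) (k : ℕ) {s : ℂ}
    (hs : s = k * lam - Y) : s ≠ 0 := by
  have := (h k 0).2
  rw [hs]; simpa using this

lemma gshift {s t : ℂ} (hs : s ≠ 0) (ht : t = s + 1) :
    Complex.Gamma t = s * Complex.Gamma s := by
  rw [ht, Complex.Gamma_add_one _ hs]

lemma rB_shift (lam : ℝ) (Y : ℂ) (h : HH lam Y) (h' : HH lam (Y + 1)) (j : ℕ) :
    rB lam (Y + 1) (j + 1) = rB lam Y (j + 1) * rS lam Y j := by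
  unfold rB rS
  have e1 : (2 * (j : ℂ) * lam - (Y + 1)) ≠ 0 := h'.neg0 (2 * j) (by push_cast; ring)
  have e2 : (2 * (j : ℂ) * lam + Y) ≠ 0 := h.pos0 (2 * j) (by push_cast; ring)
  have e3 : (2 * ((j : ℂ) + 1) * lam - Y) ≠ 0 := h.neg0 (2 * j + 2) (by push_cast; ring)
  have e4 : (2 * ((j : ℂ) + 1) * lam + (Y + 1)) ≠ 0 :=
    h'.pos0 (2 * j + 2) (by push_cast; ring)
  have e5 : ((2 * (j : ℂ) + 1) * lam + Y) ≠ 0 := h.pos0 (2 * j + 1) (by push_cast; ring)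
  have e6 : ((2 * (j : ℂ) + 1) * lam + (Y + 1)) ≠ 0 :=
    h'.pos0 (2 * j + 1) (by push_cast; ring)
  have e7 : ((2 * (j : ℂ) + 1) * lam - Y) ≠ 0 := h.neg0 (2 * j + 1) (by push_cast; ring)
  have e8 : ((2 * (j : ℂ) + 1) * lam - (Y + 1)) ≠ 0 :=
    h'.neg0 (2 * j + 1) (by push_cast; ring)
  have g1 : Complex.Gamma ((2 * ((j + 1 : ℕ) : ℂ) - 2) * lam - Y) = _ :=
    gshift e1 (by push_cast; ring)
  have g2 : Complex.Gamma ((2 * ((j + 1 : ℕ) : ℂ) - 2) * lam + (Y + 1)) = _ :=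
    gshift e2 (by push_cast; ring)
  have g3 : Complex.Gamma (1 + 2 * ((j + 1 : ℕ) : ℂ) * lam - Y) = _ :=
    gshift e3 (by push_cast; ring)
  have g4 : Complex.Gamma (1 + 2 * ((j + 1 : ℕ) : ℂ) * lam + (Y + 1)) = _ :=
    gshift e4 (by push_cast; ring)
  have g5 : Complex.Gamma ((2 * ((j + 1 : ℕ) : ℂ) - 1) * lam + (Y + 1)) = _ :=
    gshift e5 (by push_cast; ring)
  have g6 : Complex.Gamma (1 + (2 * ((j + 1 : ℕ) : ℂ) - 1) * lam + (Y + 1)) = _ :=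
    gshift e6 (by push_cast; ring)
  have g7 : Complex.Gamma (1 + (2 * ((j + 1 : ℕ) : ℂ) - 1) * lam - Y) = _ :=
    gshift e7 (by push_cast; ring)
  have g8 : Complex.Gamma ((2 * ((j + 1 : ℕ) : ℂ) - 1) * lam - Y) = _ :=
    gshift e8 (by push_cast; ring)
  rw [g1, g2, g3, g4, g5, g6, g7, g8]
  have k1 : (2 * ((j + 1 : ℕ) : ℂ) - 2) * (lam : ℂ) - (Y + 1) = 2 * (j : ℂ) * lam - (Y + 1) := by
    push_cast; ring
  have k2 : (2 * ((j + 1 : ℕ) : ℂ) - 2) * (lam : ℂ) + Y = 2 * (j : ℂ) * lam + Y := by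
    push_cast; ring
  have k3 : 1 + 2 * ((j + 1 : ℕ) : ℂ) * (lam : ℂ) - (Y + 1) = 2 * ((j : ℂ) + 1) * lam - Y := by
    push_cast; ring
  have k4 : 1 + 2 * ((j + 1 : ℕ) : ℂ) * (lam : ℂ) + Y = 2 * ((j : ℂ) + 1) * lam + (Y + 1) := by
    push_cast; ring
  have k5 : (2 * ((j + 1 : ℕ) : ℂ) - 1) * (lam : ℂ) + Y = (2 * (j : ℂ) + 1) * lam + Y := by
    push_cast; ring
  have k6 : 1 + (2 * ((j + 1 : ℕ) : ℂ) - 1) * (lam : ℂ) + Y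
      = (2 * (j : ℂ) + 1) * lam + (Y + 1) := by
    push_cast; ring
  have k7 : 1 + (2 * ((j + 1 : ℕ) : ℂ) - 1) * (lam : ℂ) - (Y + 1)
      = (2 * (j : ℂ) + 1) * lam - Y := by
    push_cast; ring
  have k8 : (2 * ((j + 1 : ℕ) : ℂ) - 1) * (lam : ℂ) - (Y + 1)
      = (2 * (j : ℂ) + 1) * lam - (Y + 1) := by
    push_cast; ring
  rw [k1, k2, k3, k4, k5, k6, k7, k8]
  have n1 : Complex.Gamma (2 * (j : ℂ) * lam - (Y + 1)) ≠ 0 :=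
    h'.neg (2 * j) 0 (by push_cast; ring)
  have n2 : Complex.Gamma (2 * (j : ℂ) * lam + Y) ≠ 0 := h.pos (2 * j) 0 (by push_cast; ring)
  have n3 : Complex.Gamma (2 * ((j : ℂ) + 1) * lam - Y) ≠ 0 :=
    h.neg (2 * j + 2) 0 (by push_cast; ring)
  have n4 : Complex.Gamma (2 * ((j : ℂ) + 1) * lam + (Y + 1)) ≠ 0 :=
    h'.pos (2 * j + 2) 0 (by push_cast; ring)
  have n5 : Complex.Gamma ((2 * (j : ℂ) + 1) * lam + Y) ≠ 0 :=
    h.pos (2 * j + 1) 0 (by push_cast; ring)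
  have n6 : Complex.Gamma ((2 * (j : ℂ) + 1) * lam + (Y + 1)) ≠ 0 :=
    h'.pos (2 * j + 1) 0 (by push_cast; ring)
  have n7 : Complex.Gamma ((2 * (j : ℂ) + 1) * lam - Y) ≠ 0 :=
    h.neg (2 * j + 1) 0 (by push_cast; ring)
  have n8 : Complex.Gamma ((2 * (j : ℂ) + 1) * lam - (Y + 1)) ≠ 0 :=
    h'.neg (2 * j + 1) 0 (by push_cast; ring)
  clear g1 g2 g3 g4 g5 g6 g7 g8 k1 k2 k3 k4 k5 k6 k7 k8
  generalize Complex.Gamma (2 * (j : ℂ) * lam - (Y + 1)) = G1 at *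
  generalize Complex.Gamma (2 * (j : ℂ) * lam + Y) = G2 at *
  generalize Complex.Gamma (2 * ((j : ℂ) + 1) * lam - Y) = G3 at *
  generalize Complex.Gamma (2 * ((j : ℂ) + 1) * lam + (Y + 1)) = G4 at *
  generalize Complex.Gamma ((2 * (j : ℂ) + 1) * lam + Y) = G5 at *
  generalize Complex.Gamma ((2 * (j : ℂ) + 1) * lam + (Y + 1)) = G6 at *
  generalize Complex.Gamma ((2 * (j : ℂ) + 1) * lam - Y) = G7 at *
  generalize Complex.Gamma ((2 * (j : ℂ) + 1) * lam - (Y + 1)) = G8 at *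
  generalize (2 * (j : ℂ) * lam - (Y + 1)) = E1 at *
  generalize (2 * (j : ℂ) * lam + Y) = E2 at *
  generalize (2 * ((j : ℂ) + 1) * lam - Y) = E3 at *
  generalize (2 * ((j : ℂ) + 1) * lam + (Y + 1)) = E4 at *
  generalize ((2 * (j : ℂ) + 1) * lam + Y) = E5 at *
  generalize ((2 * (j : ℂ) + 1) * lam + (Y + 1)) = E6 at *
  generalize ((2 * (j : ℂ) + 1) * lam - Y) = E7 at *
  generalize ((2 * (j : ℂ) + 1) * lam - (Y + 1)) = E8 at *
  field_simp

/-- Partial Euler products for sine and cosine. -/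
noncomputable def eP (z : ℂ) (L : ℕ) : ℂ :=
  (Real.pi : ℂ) * z * ∏ j ∈ Finset.range L, ((1 : ℂ) - z ^ 2 / ((j : ℂ) + 1) ^ 2)

noncomputable def cP (z : ℂ) (L : ℕ) : ℂ :=
  ∏ j ∈ Finset.range L, ((1 : ℂ) - z ^ 2 / ((j : ℂ) + 1 / 2) ^ 2)

lemma half_ne (j : ℕ) : (j : ℂ) + 1 / 2 ≠ 0 := by
  have : ((2 * j + 1 : ℕ) : ℂ) ≠ 0 := Nat.cast_ne_zero.mpr (by omega)
  intro h
  apply this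
  push_cast
  linear_combination 2 * h

lemma eP_succ (z : ℂ) (L : ℕ) :
    eP z (L + 1) = eP z L * ((1 : ℂ) - z ^ 2 / ((L : ℂ) + 1) ^ 2) := by
  unfold eP; rw [Finset.prod_range_succ]; ring

lemma cP_succ (z : ℂ) (L : ℕ) :
    cP z (L + 1) = cP z L * ((1 : ℂ) - z ^ 2 / ((L : ℂ) + 1 / 2) ^ 2) := by
  unfold cP; rw [Finset.prod_range_succ]

lemma eP_double (z : ℂ) (L : ℕ) : eP (2 * z) (2 * L) = 2 * eP z L * cP z L := by
  induction L with
  | zero => simp [eP, cP]; ring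
  | succ L ih =>
    rw [show 2 * (L + 1) = 2 * L + 1 + 1 by ring, eP_succ, eP_succ, ih, eP_succ, cP_succ]
    have h1 : (1 : ℂ) - (2 * z) ^ 2 / (((2 * L : ℕ) : ℂ) + 1) ^ 2
        = 1 - z ^ 2 / ((L : ℂ) + 1 / 2) ^ 2 := by
      have : ((2 * L : ℕ) : ℂ) + 1 = 2 * ((L : ℂ) + 1 / 2) := by push_cast; ring
      rw [this, mul_pow, mul_pow, mul_div_mul_left _ _ (by norm_num)]
    have h2 : (1 : ℂ) - (2 * z) ^ 2 / (((2 * L + 1 : ℕ) : ℂ) + 1) ^ 2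
        = 1 - z ^ 2 / ((L : ℂ) + 1) ^ 2 := by
      have : ((2 * L + 1 : ℕ) : ℂ) + 1 = 2 * ((L : ℂ) + 1) := by push_cast; ring
      rw [this, mul_pow, mul_pow, mul_div_mul_left _ _ (by norm_num)]
    rw [h1, h2]; ring

lemma eP_tendsto (z : ℂ) : Tendsto (eP z) atTop (𝓝 (Complex.sin (Real.pi * z))) :=
  Complex.tendsto_euler_sin_prod z

lemma cP_tendsto (z : ℂ) (hz : Complex.sin (Real.pi * z) ≠ 0) :
    Tendsto (cP z) atTop (𝓝 (Complex.cos (Real.pi * z))) := by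
  have h1 : Tendsto (fun L : ℕ => eP (2 * z) (2 * L)) atTop
      (𝓝 (Complex.sin (Real.pi * (2 * z)))) :=
    (eP_tendsto (2 * z)).comp (tendsto_id.const_mul_atTop' (by norm_num))
  have h2 : Tendsto (fun L : ℕ => eP (2 * z) (2 * L) / (2 * eP z L)) atTop
      (𝓝 (Complex.sin (Real.pi * (2 * z)) / (2 * Complex.sin (Real.pi * z)))) :=
    h1.div ((eP_tendsto z).const_mul 2) (mul_ne_zero two_ne_zero hz)
  have e : Complex.sin (Real.pi * (2 * z)) / (2 * Complex.sin (Real.pi * z))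
      = Complex.cos (Real.pi * z) := by
    rw [show (Real.pi : ℂ) * (2 * z) = 2 * (Real.pi * z) by ring, Complex.sin_two_mul]
    field_simp
  rw [e] at h2
  refine h2.congr' ?_
  filter_upwards [(eP_tendsto z).eventually_ne hz] with L hL
  rw [eP_double]; field_simp

/-- The shift product, without normalisation. -/
noncomputable def fP (lam : ℝ) (Y : ℂ) (L : ℕ) : ℂ :=
  cP (Y / (2 * lam)) L * cP ((Y + 1) / (2 * lam)) L *
    ((2 * L * lam + Y) * (2 * L * lam - (Y + 1))) /
  (eP (Y / (2 * lam)) L * eP ((Y + 1) / (2 * lam)) L)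

noncomputable def kP (lam : ℝ) (L : ℕ) : ℂ :=
  -((Real.pi : ℂ) ^ 2 / (4 * (lam : ℂ) ^ 2)) *
    ∏ j ∈ Finset.range L, (((j : ℂ) + 1 / 2) / ((j : ℂ) + 1)) ^ 4

lemma kP_ne (lam : ℝ) (hl : 0 < lam) (L : ℕ) : kP lam L ≠ 0 := by
  unfold kP
  have hl' : (lam : ℂ) ≠ 0 := by exact_mod_cast hl.ne'
  have hp : (Real.pi : ℂ) ≠ 0 := by exact_mod_cast Real.pi_ne_zero
  refine mul_ne_zero (neg_ne_zero.mpr (div_ne_zero (pow_ne_zero _ hp) (mul_ne_zero (by norm_num) (pow_ne_zero _ hl')))) ?_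
  rw [Finset.prod_ne_zero_iff]
  intro j _
  exact pow_ne_zero _ (div_ne_zero (half_ne j) (by exact_mod_cast Nat.succ_ne_zero j))

lemma e_factor (lam : ℝ) (hl : 0 < lam) (Y : ℂ) (j : ℕ) :
    (1 : ℂ) - (Y / (2 * lam)) ^ 2 / ((j : ℂ) + 1) ^ 2 =
      (2 * ((j : ℂ) + 1) * lam - Y) * (2 * ((j : ℂ) + 1) * lam + Y) /
        (2 * ((j : ℂ) + 1) * lam) ^ 2 := by
  have hl' : (lam : ℂ) ≠ 0 := by exact_mod_cast hl.ne'
  have hj : (j : ℂ) + 1 ≠ 0 := by exact_mod_cast Nat.succ_ne_zero j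
  field_simp
  ring

lemma c_factor (lam : ℝ) (hl : 0 < lam) (Y : ℂ) (j : ℕ) :
    (1 : ℂ) - (Y / (2 * lam)) ^ 2 / ((j : ℂ) + 1 / 2) ^ 2 =
      ((2 * (j : ℂ) + 1) * lam - Y) * ((2 * (j : ℂ) + 1) * lam + Y) /
        (2 * ((j : ℂ) + 1 / 2) * lam) ^ 2 := by
  have hl' : (lam : ℂ) ≠ 0 := by exact_mod_cast hl.ne'
  have hj := half_ne j
  generalize hw : (j : ℂ) + 1 / 2 = w at *
  have : (j : ℂ) = w - 1 / 2 := by rw [← hw]; ring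
  rw [this]
  field_simp
  ring

lemma eP_ne (lam : ℝ) (hl : 0 < lam) (Y : ℂ) (h : HH lam Y) (L : ℕ) :
    eP (Y / (2 * lam)) L ≠ 0 := by
  have hl' : (lam : ℂ) ≠ 0 := by exact_mod_cast hl.ne'
  have hp : (Real.pi : ℂ) ≠ 0 := by exact_mod_cast Real.pi_ne_zero
  unfold eP
  refine mul_ne_zero (mul_ne_zero hp (div_ne_zero (h.pos0 0 (by simp)) (by simpa using hl'))) ?_
  rw [Finset.prod_ne_zero_iff]
  intro j _
  have hj : (j : ℂ) + 1 ≠ 0 := by exact_mod_cast Nat.succ_ne_zero j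
  rw [e_factor lam hl]
  refine div_ne_zero (mul_ne_zero (h.neg0 (2 * j + 2) (by push_cast; ring))
    (h.pos0 (2 * j + 2) (by push_cast; ring))) (pow_ne_zero _ (by simp [hj, hl']))

lemma prod_rS (lam : ℝ) (hl : 0 < lam) (Y : ℂ) (h : HH lam Y) (h' : HH lam (Y + 1)) (L : ℕ) :
    ∏ j ∈ Finset.range L, rS lam Y j = kP lam L * fP lam Y L := by
  have hl' : (lam : ℂ) ≠ 0 := by exact_mod_cast hl.ne'
  have hp : (Real.pi : ℂ) ≠ 0 := by exact_mod_cast Real.pi_ne_zero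
  induction L with
  | zero =>
    have a := h.pos0 0 (s := Y) (by simp)
    have b := h'.pos0 0 (s := Y + 1) (by simp)
    simp [kP, fP, eP, cP]
    field_simp
    ring
  | succ L ih =>
    rw [Finset.prod_range_succ, ih]
    unfold fP
    rw [eP_succ, eP_succ, cP_succ, cP_succ, e_factor lam hl, e_factor lam hl, c_factor lam hl,
      c_factor lam hl]
    have hk : kP lam (L + 1) = kP lam L * (((L : ℂ) + 1 / 2) / ((L : ℂ) + 1)) ^ 4 := by
      unfold kP; rw [Finset.prod_range_succ]; ring
    rw [hk]
    unfold rS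
    have hY := eP_ne lam hl Y h L
    have hY' := eP_ne lam hl (Y + 1) h' L
    have hj := half_ne L
    have hj1 : (L : ℂ) + 1 ≠ 0 := by exact_mod_cast Nat.succ_ne_zero L
    generalize eP (Y / (2 * lam)) L = E at *
    generalize eP ((Y + 1) / (2 * lam)) L = E' at *
    generalize cP (Y / (2 * lam)) L = C at *
    generalize cP ((Y + 1) / (2 * lam)) L = C' at *
    generalize kP lam L = K at *
    have e1 : (2 * (L : ℂ) * lam - (Y + 1)) ≠ 0 := h'.neg0 (2 * L) (by push_cast; ring)
    have e2 : (2 * (L : ℂ) * lam + Y) ≠ 0 := h.pos0 (2 * L) (by push_cast; ring)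
    have e3 : (2 * ((L : ℂ) + 1) * lam - Y) ≠ 0 := h.neg0 (2 * L + 2) (by push_cast; ring)
    have e4 : (2 * ((L : ℂ) + 1) * lam + (Y + 1)) ≠ 0 :=
      h'.pos0 (2 * L + 2) (by push_cast; ring)
    have e5 : (2 * ((L : ℂ) + 1) * lam + Y) ≠ 0 := h.pos0 (2 * L + 2) (by push_cast; ring)
    have e6 : (2 * ((L : ℂ) + 1) * lam - (Y + 1)) ≠ 0 :=
      h'.neg0 (2 * L + 2) (by push_cast; ring)
    push_cast
    generalize (2 * (L : ℂ) * lam - (Y + 1)) = E1 at *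
    generalize (2 * (L : ℂ) * lam + Y) = E2 at *
    generalize (2 * ((L : ℂ) + 1) * lam - Y) = E3 at *
    generalize (2 * ((L : ℂ) + 1) * lam + (Y + 1)) = E4 at *
    generalize (2 * ((L : ℂ) + 1) * lam + Y) = E5 at *
    generalize (2 * ((L : ℂ) + 1) * lam - (Y + 1)) = E6 at *
    generalize ((2 * (L : ℂ) + 1) * lam + Y) = F5 at *
    generalize ((2 * (L : ℂ) + 1) * lam + (Y + 1)) = F6 at *
    generalize ((2 * (L : ℂ) + 1) * lam - Y) = F7 at *
    generalize ((2 * (L : ℂ) + 1) * lam - (Y + 1)) = F8 at *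
    generalize (L : ℂ) + 1 / 2 = w at *
    generalize (L : ℂ) + 1 = w' at *
    field_simp

lemma HH.int {lam : ℝ} {Y : ℂ} (h : HH lam Y) (k : ℤ) : Y ≠ k * lam := by
  obtain ⟨m, rfl | rfl⟩ := k.eq_nat_or_neg
  · intro e
    exact h.neg0 m rfl (by rw [e]; push_cast; ring)
  · intro e
    exact h.pos0 m rfl (by rw [e]; push_cast; ring)

lemma HH.sin_ne {lam : ℝ} (hl : 0 < lam) {Y : ℂ} (h : HH lam Y) :
    Complex.sin (Real.pi * (Y / (2 * lam))) ≠ 0 := by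
  have hl' : (lam : ℂ) ≠ 0 := by exact_mod_cast hl.ne'
  have hp : (Real.pi : ℂ) ≠ 0 := by exact_mod_cast Real.pi_ne_zero
  rw [Ne, Complex.sin_eq_zero_iff]
  rintro ⟨k, hk⟩
  apply h.int (2 * k)
  field_simp at hk
  push_cast
  linear_combination hk

lemma HH.cos_ne {lam : ℝ} (hl : 0 < lam) {Y : ℂ} (h : HH lam Y) :
    Complex.cos (Real.pi * (Y / (2 * lam))) ≠ 0 := by
  have hl' : (lam : ℂ) ≠ 0 := by exact_mod_cast hl.ne'
  have hp : (Real.pi : ℂ) ≠ 0 := by exact_mod_cast Real.pi_ne_zero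
  rw [Ne, Complex.cos_eq_zero_iff]
  rintro ⟨k, hk⟩
  apply h.int (2 * k + 1)
  field_simp at hk
  push_cast
  linear_combination hk

lemma lin_tendsto (lam : ℝ) (a : ℂ) :
    Tendsto (fun L : ℕ => (2 * (L : ℂ) * lam + a) / L) atTop (𝓝 (2 * lam)) := by
  have h : Tendsto (fun L : ℕ => 2 * (lam : ℂ) + a / L) atTop (𝓝 (2 * lam + 0)) :=
    tendsto_const_nhds.add (tendsto_const_div_atTop_nhds_zero_nat a)
  rw [add_zero] at h
  refine h.congr' ?_
  filter_upwards [eventually_ne_atTop 0] with L hL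
  have : (L : ℂ) ≠ 0 := by exact_mod_cast hL
  field_simp

/-- The limit of the normalised shift product. -/
noncomputable def ctt (lam : ℝ) (Y : ℂ) : ℂ :=
  Complex.cos (Real.pi * (Y / (2 * lam))) / Complex.sin (Real.pi * (Y / (2 * lam)))

lemma fP_tendsto (lam : ℝ) (hl : 0 < lam) (Y : ℂ) (h : HH lam Y) (h' : HH lam (Y + 1)) :
    Tendsto (fun L : ℕ => fP lam Y L / (L : ℂ) ^ 2) atTop
      (𝓝 (ctt lam Y * ctt lam (Y + 1) * (2 * lam) ^ 2)) := by
  have s := h.sin_ne hl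
  have s' := h'.sin_ne hl
  have t1 := (cP_tendsto _ s).div (eP_tendsto _) s
  have t2 := (cP_tendsto _ s').div (eP_tendsto _) s'
  have t3 := (lin_tendsto lam Y).mul (lin_tendsto lam (-(Y + 1)))
  have t := (t1.mul t2).mul t3
  have e : ctt lam Y * ctt lam (Y + 1) * (2 * (lam : ℂ)) ^ 2 =
    Complex.cos (Real.pi * (Y / (2 * lam))) / Complex.sin (Real.pi * (Y / (2 * lam))) *
    (Complex.cos (Real.pi * ((Y + 1) / (2 * lam))) /
      Complex.sin (Real.pi * ((Y + 1) / (2 * lam)))) * (2 * lam * (2 * lam)) := by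
    unfold ctt; ring
  rw [e]
  refine t.congr ?_
  intro L
  simp only [fP, Pi.div_apply]
  rw [div_mul_div_comm, div_mul_div_comm, div_mul_div_comm, div_div]
  congr 1
  ring

lemma ratio_tendsto (lam : ℝ) (hl : 0 < lam) (p q : ℂ) (h : HH lam p) (h' : HH lam (p + 1))
    (k : HH lam q) (k' : HH lam (q + 1)) :
    Tendsto (fun L : ℕ => fP lam p L / fP lam q L) atTop
      (𝓝 ((ctt lam p * ctt lam (p + 1)) / (ctt lam q * ctt lam (q + 1)))) := by
  have hl' : (lam : ℂ) ≠ 0 := by exact_mod_cast hl.ne'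
  have a : ctt lam q ≠ 0 := div_ne_zero (k.cos_ne hl) (k.sin_ne hl)
  have b : ctt lam (q + 1) ≠ 0 := div_ne_zero (k'.cos_ne hl) (k'.sin_ne hl)
  have c : (2 * (lam : ℂ)) ^ 2 ≠ 0 := by simp [hl']
  have t := (fP_tendsto lam hl p h h').div (fP_tendsto lam hl q k k')
    (mul_ne_zero (mul_ne_zero a b) c)
  rw [mul_div_mul_right _ _ c] at t
  refine t.congr' ?_
  filter_upwards [eventually_ne_atTop 0] with L hL
  have : (L : ℂ) ^ 2 ≠ 0 := pow_ne_zero _ (by exact_mod_cast hL)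
  simp only [Pi.div_apply]
  rw [div_div_div_cancel_right₀ this]

lemma prod_Icc_range (f : ℕ → ℂ) (L : ℕ) :
    ∏ l ∈ Finset.Icc 1 L, f l = ∏ j ∈ Finset.range L, f (j + 1) := by
  induction L with
  | zero => simp
  | succ L ih => rw [Finset.prod_Icc_succ_top (by omega), ih, Finset.prod_range_succ]

lemma prod_rB (lam : ℝ) (hl : 0 < lam) (p : ℂ) (L n : ℕ)
    (h : ∀ i ≤ n, HH lam (p + (i : ℂ))) :
    ∏ j ∈ Finset.range L, rB lam (p + (n : ℂ)) (j + 1) =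
      (∏ j ∈ Finset.range L, rB lam p (j + 1)) *
        ∏ i ∈ Finset.range n, (kP lam L * fP lam (p + (i : ℂ)) L) := by
  induction n with
  | zero => simp
  | succ n ih =>
    have h1 := h n (by omega)
    have h2 := h (n + 1) le_rfl
    push_cast at h2
    rw [← add_assoc] at h2
    rw [Finset.prod_range_succ, ← mul_assoc, ← ih (fun i hi => h i (by omega)),
      ← prod_rS lam hl _ h1 h2, ← Finset.prod_mul_distrib]
    refine Finset.prod_congr rfl fun j _ => ?_
    rw [← rB_shift lam _ h1 h2]
    push_cast
    rw [add_assoc]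

lemma rB_neg (lam : ℝ) (Y : ℂ) (l : ℕ) : rB lam (-Y) l = (rB lam Y l)⁻¹ := by
  unfold rB
  rw [inv_div]
  simp only [sub_neg_eq_add, ← sub_eq_add_neg]
  congr 1 <;> ring

lemma rB_ne (lam : ℝ) (Y : ℂ) (h : HH lam Y) (j : ℕ) : rB lam Y (j + 1) ≠ 0 := by
  unfold rB
  refine div_ne_zero (mul_ne_zero (mul_ne_zero (mul_ne_zero ?_ ?_) ?_) ?_)
    (mul_ne_zero (mul_ne_zero (mul_ne_zero ?_ ?_) ?_) ?_)
  · exact h.neg (2 * j) 0 (by push_cast; ring)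
  · exact h.neg (2 * j + 2) 1 (by push_cast; ring)
  · exact h.pos (2 * j + 1) 0 (by push_cast; ring)
  · exact h.pos (2 * j + 1) 1 (by push_cast; ring)
  · exact h.neg (2 * j + 1) 0 (by push_cast; ring)
  · exact h.neg (2 * j + 1) 1 (by push_cast; ring)
  · exact h.pos (2 * j) 0 (by push_cast; ring)
  · exact h.pos (2 * j + 2) 1 (by push_cast; ring)

lemma gamma_quot {s1 s2 s3 s4 s5 s6 s7 s8 t1 t2 t3 t4 t5 t6 t7 t8 : ℂ}
    (h1 : s1 = t1) (h2 : s2 = t2) (h3 : s3 = t3) (h4 : s4 = t4)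
    (h5 : s5 = t5) (h6 : s6 = t6) (h7 : s7 = t7) (h8 : s8 = t8) :
    (Complex.Gamma s1 * Complex.Gamma s2 * Complex.Gamma s3 * Complex.Gamma s4) /
      (Complex.Gamma s5 * Complex.Gamma s6 * Complex.Gamma s7 * Complex.Gamma s8) =
    (Complex.Gamma t1 * Complex.Gamma t2 * Complex.Gamma t3 * Complex.Gamma t4) /
      (Complex.Gamma t5 * Complex.Gamma t6 * Complex.Gamma t7 * Complex.Gamma t8) := by
  rw [h1, h2, h3, h4, h5, h6, h7, h8]

lemma gBlock_pq (lam ξ : ℝ) (u p q : ℂ) (l : ℕ)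
    (hp : p = 1 / 2 - (ξ : ℂ) / Real.pi + lam * u / Real.pi)
    (hq : q = 1 / 2 - (ξ : ℂ) / Real.pi - lam * u / Real.pi) :
    gBlock lam ξ u l =
    (Complex.Gamma (1 + 2 * (l : ℂ) * lam - q) * Complex.Gamma ((2 * (l : ℂ) - 2) * lam + p) *
     Complex.Gamma (1 + (2 * (l : ℂ) - 1) * lam - p) *
     Complex.Gamma ((2 * (l : ℂ) - 1) * lam + q)) /
    (Complex.Gamma (1 + (2 * (l : ℂ) - 1) * lam - q) *
     Complex.Gamma ((2 * (l : ℂ) - 1) * lam + p) *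
     Complex.Gamma (1 + 2 * (l : ℂ) * lam - p) *
     Complex.Gamma ((2 * (l : ℂ) - 2) * lam + q)) := by
  unfold gBlock
  subst hp hq
  refine gamma_quot ?_ ?_ ?_ ?_ ?_ ?_ ?_ ?_ <;> ring

lemma gBlock_pq' (lam ξ : ℝ) (u p q : ℂ) (l : ℕ)
    (hp : p = 1 / 2 - (ξ : ℂ) / Real.pi + lam * u / Real.pi)
    (hq : q = 1 / 2 - (ξ : ℂ) / Real.pi - lam * u / Real.pi) :
    gBlock lam (-(Real.pi * (lam + 1) - ξ)) u l =
    (Complex.Gamma ((2 * (l : ℂ) - 1) * lam - q) *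
     Complex.Gamma (1 + (2 * (l : ℂ) - 1) * lam + p) *
     Complex.Gamma ((2 * (l : ℂ) - 2) * lam - p) *
     Complex.Gamma (1 + 2 * (l : ℂ) * lam + q)) /
    (Complex.Gamma ((2 * (l : ℂ) - 2) * lam - q) *
     Complex.Gamma (1 + 2 * (l : ℂ) * lam + p) *
     Complex.Gamma ((2 * (l : ℂ) - 1) * lam - p) *
     Complex.Gamma (1 + (2 * (l : ℂ) - 1) * lam + q)) := by
  have hpi : (Real.pi : ℂ) ≠ 0 := by exact_mod_cast Real.pi_ne_zero
  have e : ((-(Real.pi * (lam + 1) - ξ) : ℝ) : ℂ) / Real.pi = (ξ : ℂ) / Real.pi - lam - 1 := by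
    push_cast; field_simp; ring
  unfold gBlock
  rw [e]
  subst hp hq
  refine gamma_quot ?_ ?_ ?_ ?_ ?_ ?_ ?_ ?_ <;> ring

lemma block_id (lam ξ : ℝ) (u p q : ℂ) (j : ℕ)
    (hp : p = 1 / 2 - (ξ : ℂ) / Real.pi + lam * u / Real.pi)
    (hq : q = 1 / 2 - (ξ : ℂ) / Real.pi - lam * u / Real.pi)
    (h : HH lam p) (k : HH lam q) :
    gBlock lam ξ u (j + 1) * rB lam p (j + 1) * (rB lam q (j + 1))⁻¹ =
      gBlock lam (-(Real.pi * (lam + 1) - ξ)) u (j + 1) := by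
  rw [gBlock_pq lam ξ u p q _ hp hq, gBlock_pq' lam ξ u p q _ hp hq]
  unfold rB
  have a1 : Complex.Gamma ((2 * ((j + 1 : ℕ) : ℂ) - 2) * lam - p) ≠ 0 :=
    h.neg (2 * j) 0 (by push_cast; ring)
  have a2 : Complex.Gamma (1 + 2 * ((j + 1 : ℕ) : ℂ) * lam - p) ≠ 0 :=
    h.neg (2 * j + 2) 1 (by push_cast; ring)
  have a3 : Complex.Gamma ((2 * ((j + 1 : ℕ) : ℂ) - 1) * lam + p) ≠ 0 :=
    h.pos (2 * j + 1) 0 (by push_cast; ring)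
  have a4 : Complex.Gamma (1 + (2 * ((j + 1 : ℕ) : ℂ) - 1) * lam + p) ≠ 0 :=
    h.pos (2 * j + 1) 1 (by push_cast; ring)
  have a5 : Complex.Gamma ((2 * ((j + 1 : ℕ) : ℂ) - 1) * lam - p) ≠ 0 :=
    h.neg (2 * j + 1) 0 (by push_cast; ring)
  have a6 : Complex.Gamma (1 + (2 * ((j + 1 : ℕ) : ℂ) - 1) * lam - p) ≠ 0 :=
    h.neg (2 * j + 1) 1 (by push_cast; ring)
  have a7 : Complex.Gamma ((2 * ((j + 1 : ℕ) : ℂ) - 2) * lam + p) ≠ 0 :=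
    h.pos (2 * j) 0 (by push_cast; ring)
  have a8 : Complex.Gamma (1 + 2 * ((j + 1 : ℕ) : ℂ) * lam + p) ≠ 0 :=
    h.pos (2 * j + 2) 1 (by push_cast; ring)
  have b1 : Complex.Gamma ((2 * ((j + 1 : ℕ) : ℂ) - 2) * lam - q) ≠ 0 :=
    k.neg (2 * j) 0 (by push_cast; ring)
  have b2 : Complex.Gamma (1 + 2 * ((j + 1 : ℕ) : ℂ) * lam - q) ≠ 0 :=
    k.neg (2 * j + 2) 1 (by push_cast; ring)
  have b3 : Complex.Gamma ((2 * ((j + 1 : ℕ) : ℂ) - 1) * lam + q) ≠ 0 :=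
    k.pos (2 * j + 1) 0 (by push_cast; ring)
  have b4 : Complex.Gamma (1 + (2 * ((j + 1 : ℕ) : ℂ) - 1) * lam + q) ≠ 0 :=
    k.pos (2 * j + 1) 1 (by push_cast; ring)
  have b5 : Complex.Gamma ((2 * ((j + 1 : ℕ) : ℂ) - 1) * lam - q) ≠ 0 :=
    k.neg (2 * j + 1) 0 (by push_cast; ring)
  have b6 : Complex.Gamma (1 + (2 * ((j + 1 : ℕ) : ℂ) - 1) * lam - q) ≠ 0 :=
    k.neg (2 * j + 1) 1 (by push_cast; ring)
  have b7 : Complex.Gamma ((2 * ((j + 1 : ℕ) : ℂ) - 2) * lam + q) ≠ 0 :=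
    k.pos (2 * j) 0 (by push_cast; ring)
  have b8 : Complex.Gamma (1 + 2 * ((j + 1 : ℕ) : ℂ) * lam + q) ≠ 0 :=
    k.pos (2 * j + 2) 1 (by push_cast; ring)
  generalize Complex.Gamma ((2 * ((j + 1 : ℕ) : ℂ) - 2) * lam - p) = A1 at *
  generalize Complex.Gamma (1 + 2 * ((j + 1 : ℕ) : ℂ) * lam - p) = A2 at *
  generalize Complex.Gamma ((2 * ((j + 1 : ℕ) : ℂ) - 1) * lam + p) = A3 at *
  generalize Complex.Gamma (1 + (2 * ((j + 1 : ℕ) : ℂ) - 1) * lam + p) = A4 at *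
  generalize Complex.Gamma ((2 * ((j + 1 : ℕ) : ℂ) - 1) * lam - p) = A5 at *
  generalize Complex.Gamma (1 + (2 * ((j + 1 : ℕ) : ℂ) - 1) * lam - p) = A6 at *
  generalize Complex.Gamma ((2 * ((j + 1 : ℕ) : ℂ) - 2) * lam + p) = A7 at *
  generalize Complex.Gamma (1 + 2 * ((j + 1 : ℕ) : ℂ) * lam + p) = A8 at *
  generalize Complex.Gamma ((2 * ((j + 1 : ℕ) : ℂ) - 2) * lam - q) = B1 at *
  generalize Complex.Gamma (1 + 2 * ((j + 1 : ℕ) : ℂ) * lam - q) = B2 at *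
  generalize Complex.Gamma ((2 * ((j + 1 : ℕ) : ℂ) - 1) * lam + q) = B3 at *
  generalize Complex.Gamma (1 + (2 * ((j + 1 : ℕ) : ℂ) - 1) * lam + q) = B4 at *
  generalize Complex.Gamma ((2 * ((j + 1 : ℕ) : ℂ) - 1) * lam - q) = B5 at *
  generalize Complex.Gamma (1 + (2 * ((j + 1 : ℕ) : ℂ) - 1) * lam - q) = B6 at *
  generalize Complex.Gamma ((2 * ((j + 1 : ℕ) : ℂ) - 2) * lam + q) = B7 at *
  generalize Complex.Gamma (1 + 2 * ((j + 1 : ℕ) : ℂ) * lam + q) = B8 at *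
  field_simp

lemma block_ne (f : ℕ → ℂ) (v : ℂ) (hv : v ≠ 0)
    (h : Tendsto (fun L : ℕ => ∏ l ∈ Finset.Icc 1 L, f l) atTop (𝓝 v)) (j : ℕ) :
    f (j + 1) ≠ 0 := by
  obtain ⟨L, h1, h2⟩ := ((h.eventually_ne hv).and (eventually_ge_atTop (j + 1))).exists
  rw [Finset.prod_ne_zero_iff] at h1
  exact h1 _ (Finset.mem_Icc.mpr ⟨by omega, h2⟩)

lemma aPartial_eq (lam : ℝ) (v A : ℂ) (hA : A ≠ 0)
    (h : Tendsto (aPartial lam v) atTop (𝓝 A)) (L : ℕ) :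
    aPartial lam v L = -∏ l ∈ Finset.Icc 1 L, rB lam (lam * v / Real.pi) l := by
  have hs : Complex.sin ((lam : ℂ) * (v - Real.pi)) ≠ 0 := by
    obtain ⟨L, h1⟩ := (h.eventually_ne hA).exists
    intro h0
    apply h1
    simp [aPartial, h0]
  have e : Complex.sin ((lam : ℂ) * ((Real.pi : ℂ) - v))
      = -Complex.sin ((lam : ℂ) * (v - Real.pi)) := by
    rw [← Complex.sin_neg]; congr 1; ring
  unfold aPartial
  rw [e, ← mul_assoc, mul_one_div, neg_div, div_self hs, neg_one_mul]
  rfl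

lemma blk_ratio (y : ℝ) (u : ℂ) :
    blk y u / blk (y + 1) u =
      -((Complex.cos ((u - (Real.pi * y : ℝ)) / 2) / Complex.sin ((u - (Real.pi * y : ℝ)) / 2)) /
       (Complex.cos ((u + (Real.pi * y : ℝ)) / 2) / Complex.sin ((u + (Real.pi * y : ℝ)) / 2))) := by
  unfold blk
  have h1 : (u + ((Real.pi * (y + 1) : ℝ) : ℂ)) / 2
      = (u + (Real.pi * y : ℝ)) / 2 + Real.pi / 2 := by push_cast; ring
  have h2 : (u - ((Real.pi * (y + 1) : ℝ) : ℂ)) / 2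
      = (u - (Real.pi * y : ℝ)) / 2 - Real.pi / 2 := by push_cast; ring
  rw [h1, h2, Complex.sin_add_pi_div_two, Complex.sin_sub_pi_div_two]
  simp only [div_eq_mul_inv, mul_inv, inv_inv, inv_neg]
  ring

lemma nonpole {s : ℂ} (h : Complex.Gamma s ≠ 0) (m : ℕ) : s ≠ -(m : ℂ) := by
  intro e
  exact h (by rw [e, Complex.Gamma_neg_nat_eq_zero])

lemma nonpole' {s t : ℂ} (h : Complex.Gamma s ≠ 0) (e : s = t) (m : ℕ) : t ≠ -(m : ℂ) :=
  e ▸ nonpole h m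

/-- The boundary-bootstrap identity `P^+(u) a(u−ν_n) a(u+ν_n) = \bar{P^-}(u) a^1_n(u)`
(in particular for `n = 0`, where `a^1_0 = 1`), valid at every complex `u` at which all
the infinite products involved converge to nonzero values.  Here `P^+ = R_0 · G^+` and
`\bar{P^-} = R_0 · G^-|_{ξ → π(λ+1)−ξ}`, with `G^-` being `G^+` with `ξ ↦ −ξ`. -/
theorem stmt4 (lam ξ : ℝ) (hlam : 1 < lam) (hxi0 : 0 < ξ)
    (hxi1 : ξ < Real.pi * (lam + 1) / 2) (n : ℕ) (u : ℂ)
    (R0v Gp Gmbar Am Ap : ℂ)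
    (hR0 : Tendsto (r0Partial lam u) atTop (𝓝 R0v)) (hR00 : R0v ≠ 0)
    (hGp : Tendsto (gPartial lam ξ u) atTop (𝓝 Gp)) (hGp0 : Gp ≠ 0)
    (hGmbar : Tendsto (gPartial lam (-(Real.pi * (lam + 1) - ξ)) u) atTop (𝓝 Gmbar))
    (hGmbar0 : Gmbar ≠ 0)
    (hAm : Tendsto (aPartial lam (u - (nuP lam ξ n : ℝ))) atTop (𝓝 Am)) (hAm0 : Am ≠ 0)
    (hAp : Tendsto (aPartial lam (u + (nuP lam ξ n : ℝ))) atTop (𝓝 Ap)) (hAp0 : Ap ≠ 0) :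
    (R0v * Gp) * Am * Ap = (R0v * Gmbar) * a1 lam ξ n u := by
  have hl : 0 < lam := by linarith
  have hl' : (lam : ℂ) ≠ 0 := by exact_mod_cast hl.ne'
  have hpi : (Real.pi : ℂ) ≠ 0 := by exact_mod_cast Real.pi_ne_zero
  obtain ⟨p, hp⟩ : ∃ p : ℂ, p = 1 / 2 - (ξ : ℂ) / Real.pi + lam * u / Real.pi := ⟨_, rfl⟩
  obtain ⟨q, hq⟩ : ∃ q : ℂ, q = 1 / 2 - (ξ : ℂ) / Real.pi - lam * u / Real.pi := ⟨_, rfl⟩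
  have hY : (lam : ℂ) * (u - (nuP lam ξ n : ℝ)) / Real.pi = p + n := by
    rw [hp, nuP]; push_cast; field_simp; ring
  have hZ : (lam : ℂ) * (u + (nuP lam ξ n : ℝ)) / Real.pi = -(q + n) := by
    rw [hq, nuP]; push_cast; field_simp; ring
  have am := aPartial_eq lam _ _ hAm0 hAm
  have ap := aPartial_eq lam _ _ hAp0 hAp
  rw [hY] at am
  rw [hZ] at ap
  -- non-vanishing of all blocks
  have gne := block_ne _ _ hGp0 hGp
  have mne : ∀ j : ℕ, rB lam (p + n) (j + 1) ≠ 0 := by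
    refine block_ne _ (-Am) (neg_ne_zero.mpr hAm0) ?_
    refine hAm.neg.congr fun L => ?_
    rw [am, neg_neg]
  have pne : ∀ j : ℕ, rB lam (-(q + n)) (j + 1) ≠ 0 := by
    refine block_ne _ (-Ap) (neg_ne_zero.mpr hAp0) ?_
    refine hAp.neg.congr fun L => ?_
    rw [ap, neg_neg]
  have hg : ∀ k m : ℕ, ((k : ℂ) * lam + p ≠ -(m : ℂ)) ∧ ((k : ℂ) * lam + q ≠ -(m : ℂ)) := by
    intro k m
    obtain ⟨j, hj⟩ := k.even_or_odd'
    have h := gne j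
    rw [gBlock_pq lam ξ u p q _ hp hq] at h
    simp only [ne_eq, div_eq_zero_iff, mul_eq_zero, not_or] at h
    obtain ⟨⟨⟨⟨-, h1⟩, -⟩, h2⟩, ⟨⟨-, h3⟩, -⟩, h4⟩ := h
    rcases hj with rfl | rfl
    · exact ⟨nonpole' h1 (by push_cast; ring) m, nonpole' h4 (by push_cast; ring) m⟩
    · exact ⟨nonpole' h3 (by push_cast; ring) m, nonpole' h2 (by push_cast; ring) m⟩
  have hm : ∀ k m : ℕ, (k : ℂ) * lam - (p + n) ≠ -(m : ℂ) := by
    intro k m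
    obtain ⟨j, hj⟩ := k.even_or_odd'
    have h := mne j
    unfold rB at h
    simp only [ne_eq, div_eq_zero_iff, mul_eq_zero, not_or] at h
    obtain ⟨⟨⟨⟨h1, -⟩, -⟩, -⟩, ⟨⟨h2, -⟩, -⟩, -⟩ := h
    rcases hj with rfl | rfl
    · exact nonpole' h1 (by push_cast; ring) m
    · exact nonpole' h2 (by push_cast; ring) m
  have hm' : ∀ k m : ℕ, (k : ℂ) * lam - (q + n) ≠ -(m : ℂ) := by
    intro k m
    obtain ⟨j, hj⟩ := k.even_or_odd'
    have h := pne j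
    unfold rB at h
    simp only [ne_eq, div_eq_zero_iff, mul_eq_zero, not_or] at h
    obtain ⟨⟨⟨-, h2⟩, -⟩, ⟨-, h1⟩, -⟩ := h
    rcases hj with rfl | rfl
    · exact nonpole' h1 (by push_cast; ring) m
    · exact nonpole' h2 (by push_cast; ring) m
  have Hp : ∀ i ≤ n, HH lam (p + (i : ℂ)) := by
    intro i hi k m
    obtain ⟨d, rfl⟩ := Nat.exists_eq_add_of_le hi
    refine ⟨fun e => (hg k (m + i)).1 ?_, fun e => hm k (m + d) ?_⟩
    · push_cast; linear_combination e
    · push_cast; linear_combination e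
  have Hq : ∀ i ≤ n, HH lam (q + (i : ℂ)) := by
    intro i hi k m
    obtain ⟨d, rfl⟩ := Nat.exists_eq_add_of_le hi
    refine ⟨fun e => (hg k (m + i)).2 ?_, fun e => hm' k (m + d) ?_⟩
    · push_cast; linear_combination e
    · push_cast; linear_combination e
  have Hp0 : HH lam p := by simpa using Hp 0 (Nat.zero_le n)
  have Hq0 : HH lam q := by simpa using Hq 0 (Nat.zero_le n)
  -- identity of partial products
  have key : ∀ L : ℕ, gPartial lam ξ u L * aPartial lam (u - (nuP lam ξ n : ℝ)) L *
      aPartial lam (u + (nuP lam ξ n : ℝ)) L =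
      gPartial lam (-(Real.pi * (lam + 1) - ξ)) u L *
        ∏ i ∈ Finset.range n, (fP lam (p + (i : ℂ)) L / fP lam (q + (i : ℂ)) L) := by
    intro L
    rw [am, ap]
    unfold gPartial
    simp only [prod_Icc_range, rB_neg]
    rw [Finset.prod_inv_distrib, prod_rB lam hl p L n Hp, prod_rB lam hl q L n Hq]
    have e1 : ∏ j ∈ Finset.range L, gBlock lam (-(Real.pi * (lam + 1) - ξ)) u (j + 1) =
        (∏ j ∈ Finset.range L, gBlock lam ξ u (j + 1)) *
        (∏ j ∈ Finset.range L, rB lam p (j + 1)) *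
        (∏ j ∈ Finset.range L, rB lam q (j + 1))⁻¹ := by
      rw [← Finset.prod_inv_distrib, ← Finset.prod_mul_distrib, ← Finset.prod_mul_distrib]
      exact Finset.prod_congr rfl fun j _ => (block_id lam ξ u p q j hp hq Hp0 Hq0).symm
    have e2 : ∏ i ∈ Finset.range n, (fP lam (p + (i : ℂ)) L / fP lam (q + (i : ℂ)) L) =
        (∏ i ∈ Finset.range n, (kP lam L * fP lam (p + (i : ℂ)) L)) *
        (∏ i ∈ Finset.range n, (kP lam L * fP lam (q + (i : ℂ)) L))⁻¹ := by
      rw [← div_eq_mul_inv, ← Finset.prod_div_distrib]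
      exact Finset.prod_congr rfl fun i _ => (mul_div_mul_left _ _ (kP_ne lam hl L)).symm
    rw [e1, e2, mul_inv]
    ring
  -- the limit of the shift factors
  have lim : Tendsto (fun L : ℕ => ∏ i ∈ Finset.range n,
      (fP lam (p + (i : ℂ)) L / fP lam (q + (i : ℂ)) L)) atTop (𝓝 (a1 lam ξ n u)) := by
    have ea : a1 lam ξ n u = ∏ i ∈ Finset.range n,
        ((ctt lam (p + (i : ℂ)) * ctt lam (p + (i : ℂ) + 1)) /
          (ctt lam (q + (i : ℂ)) * ctt lam (q + (i : ℂ) + 1))) := by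
      unfold a1
      rw [prod_Icc_range]
      refine Finset.prod_congr rfl fun i _ => ?_
      have cp : ∀ (y : ℝ) (Y : ℂ), Y = lam * u / Real.pi - lam * y →
          Complex.cos ((u - (Real.pi * y : ℝ)) / 2) / Complex.sin ((u - (Real.pi * y : ℝ)) / 2)
            = ctt lam Y := by
        intro y Y h
        have : (u - (Real.pi * y : ℝ)) / 2 = Real.pi * (Y / (2 * lam)) := by
          rw [h]; push_cast; field_simp
        rw [this]; rfl
      have cq : ∀ (y : ℝ) (Y : ℂ), Y = -(lam * u / Real.pi) - lam * y →
          Complex.cos ((u + (Real.pi * y : ℝ)) / 2) / Complex.sin ((u + (Real.pi * y : ℝ)) / 2)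
            = -ctt lam Y := by
        intro y Y h
        have : (u + (Real.pi * y : ℝ)) / 2 = -(Real.pi * (Y / (2 * lam))) := by
          rw [h]; push_cast; field_simp; ring
        rw [this, Complex.cos_neg, Complex.sin_neg, div_neg]; rfl
      rw [mul_div_mul_comm, blk_ratio, blk_ratio]
      rw [cp _ (p + i) (by rw [hp]; push_cast; field_simp; ring),
        cp _ (p + i + 1) (by rw [hp]; push_cast; field_simp; ring),
        cq _ (q + i) (by rw [hq]; push_cast; field_simp; ring),
        cq _ (q + i + 1) (by rw [hq]; push_cast; field_simp; ring)]
      rw [div_neg, div_neg, neg_neg, neg_neg, div_mul_div_comm]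
    rw [ea]
    refine tendsto_finsetProd _ fun i hi => ?_
    have hi' := Finset.mem_range.mp hi
    have s1 := Hp (i + 1) hi'
    have s2 := Hq (i + 1) hi'
    push_cast at s1 s2
    rw [← add_assoc] at s1 s2
    exact ratio_tendsto lam hl _ _ (Hp i hi'.le) s1 (Hq i hi'.le) s2
  have fin : Gp * Am * Ap = Gmbar * a1 lam ξ n u := by
    refine tendsto_nhds_unique ((hGp.mul hAm).mul hAp) ?_
    exact (hGmbar.mul lim).congr fun L => (key L).symm
  linear_combination R0v * fin
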